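/- Let G be a 2K2-free finite simple graph, let ab be an edge of G, and let X be a minimal dominating set of G with a, b ∈ X and |X| > α(G). With N, A, Y, Z defined as in the context, if |Y| > 1 then every vertex of Y is adjacent to both a and b. -/

import Mathlib

/-- A set `D` of vertices is dominating if every vertex not in `D` has a neighbour in `D`. -/
def Dominating {V : Type*} (G : SimpleGraph V) (D : Set V) : Prop :=
  ∀ v ∉ D, ∃ u ∈ D, G.Adj u v

/-- `D` is a minimal dominating set if it is dominating and no proper subset is dominating. -/
def MinimalDominating {V : Type*} (G : SimpleGraph V) (D : Set V) : Prop :=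
  Dominating G D ∧ ∀ D' ⊂ D, ¬ Dominating G D'

/-- An independent set is a set of pairwise non-adjacent vertices. -/
def IndepSet {V : Type*} (G : SimpleGraph V) (S : Set V) : Prop :=
  ∀ u ∈ S, ∀ v ∈ S, ¬ G.Adj u v

/-- `α(G)`: the maximum cardinality of an independent set of `G`. -/
noncomputable def indepNum {V : Type*} (G : SimpleGraph V) : ℕ :=
  sSup {n | ∃ S : Set V, IndepSet G S ∧ S.ncard = n}

/-- For `x ∈ D`, a vertex `y ∉ D` is a private neighbour of `x` (w.r.t. `D`) if `x` is the
only neighbour of `y` in `D`. -/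
def PrivateNbr {V : Type*} (G : SimpleGraph V) (D : Set V) (x y : V) : Prop :=
  x ∈ D ∧ y ∉ D ∧ G.Adj x y ∧ ∀ z ∈ D, G.Adj z y → z = x

/-- `G` is `2K₂`-free: it contains no induced subgraph isomorphic to the disjoint union of
two edges, i.e. any two edges on four distinct vertices are joined by some cross edge. -/
def TwoK2Free {V : Type*} (G : SimpleGraph V) : Prop :=
  ∀ a b c d : V, G.Adj a b → G.Adj c d → a ≠ c → a ≠ d → b ≠ c → b ≠ d →
    G.Adj a c ∨ G.Adj a d ∨ G.Adj b c ∨ G.Adj b d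

theorem exists_private {V : Type*} (G : SimpleGraph V) (X : Set V)
    (hX : MinimalDominating G X) (x u : V) (hx : x ∈ X) (hu : u ∈ X) (hxu : G.Adj x u) :
    ∃ p, p ∉ X ∧ G.Adj x p ∧ ∀ z ∈ X, G.Adj z p → z = x := by
  by_contra! hcon
  apply hX.2 (X \ {x})
  · refine ⟨Set.diff_subset, fun h => ?_⟩
    exact (h hx).2 rfl
  · intro v hv
    by_cases hvx : v = x
    · subst hvx
      exact ⟨u, ⟨hu, fun h => hxu.ne (Set.mem_singleton_iff.1 h).symm⟩, hxu.symm⟩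
    · have hvX : v ∉ X := fun h => hv ⟨h, hvx⟩
      obtain ⟨w, hw, hwv⟩ := hX.1 v hvX
      by_cases hwx : w = x
      · subst hwx
        obtain ⟨z, hz, hzv, hne⟩ := hcon v hvX hwv
        exact ⟨z, ⟨hz, hne⟩, hzv⟩
      · exact ⟨w, ⟨hw, hwx⟩, hwv⟩

theorem claim4_aux {V : Type*} (G : SimpleGraph V) (h2 : TwoK2Free G)
    (a b : V) (hab : G.Adj a b)
    (X : Set V) (hX : MinimalDominating G X) (ha : a ∈ X) (hb : b ∈ X)
    (y y₂ : V) (hy : y ∈ X) (hy₂ : y₂ ∈ X) (hne : y ≠ y₂)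
    (hyb : y ≠ b) (hy₂a : y₂ ≠ a) (hy₂b : y₂ ≠ b)
    (hay : G.Adj a y) (hadj : G.Adj a y₂ ∨ G.Adj b y₂) : G.Adj b y := by
  by_contra hby
  obtain ⟨b', hb'X, hbb', hb'⟩ := exists_private G X hX b a hb ha hab.symm
  obtain ⟨z, hzX, hyz, hz⟩ := exists_private G X hX y a hy ha hay.symm
  obtain ⟨z₂, hz₂X, hyz₂, hz₂⟩ : ∃ p, p ∉ X ∧ G.Adj y₂ p ∧ ∀ z ∈ X, G.Adj z p → z = y₂ := by
    rcases hadj with h | h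
    · exact exists_private G X hX y₂ a hy₂ ha h.symm
    · exact exists_private G X hX y₂ b hy₂ hb h.symm
  have hya : y ≠ a := hay.ne'
  have e1 : ¬ G.Adj y b' := fun h => hyb (hb' y hy h)
  have e2 : ¬ G.Adj a b' := fun h => hab.ne (hb' a ha h)
  have e3 : ¬ G.Adj y₂ b' := fun h => hy₂b (hb' y₂ hy₂ h)
  have e4 : ¬ G.Adj a z := fun h => hya (hz a ha h).symm
  have e5 : ¬ G.Adj b z := fun h => hyb (hz b hb h).symm
  have e6 : ¬ G.Adj y₂ z := fun h => hne (hz y₂ hy₂ h).symm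
  have e7 : ¬ G.Adj a z₂ := fun h => hy₂a (hz₂ a ha h).symm
  have e8 : ¬ G.Adj b z₂ := fun h => hy₂b (hz₂ b hb h).symm
  have e9 : ¬ G.Adj y z₂ := fun h => hne (hz₂ y hy h)
  have nX : ∀ u ∈ X, ∀ v ∉ X, u ≠ v := fun u hu v hv h => hv (h ▸ hu)
  have nbz : b' ≠ z := fun h => e5 (h ▸ hbb')
  have nbz₂ : b' ≠ z₂ := fun h => e8 (h ▸ hbb')
  have nzz : z ≠ z₂ := fun h => e9 (h ▸ hyz)
  have zz : ¬ G.Adj z z₂ := by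
    intro h
    rcases h2 a b z z₂ hab h (nX _ ha _ hzX) (nX _ ha _ hz₂X) (nX _ hb _ hzX)
      (nX _ hb _ hz₂X) with h | h | h | h <;> contradiction
  have f1 : G.Adj b' z := by
    rcases h2 b b' y z hbb' hyz hyb.symm (nX _ hb _ hzX) (nX _ hy _ hb'X).symm nbz
      with h | h | h | h
    · exact absurd h hby
    · exact absurd h e5
    · exact absurd h.symm e1
    · exact h
  have f2 : G.Adj b' z₂ := by
    rcases h2 b' z y₂ z₂ f1 hyz₂ (nX _ hy₂ _ hb'X).symm nbz₂ (nX _ hy₂ _ hzX).symm nzz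
      with h | h | h | h
    · exact absurd h.symm e3
    · exact h
    · exact absurd h.symm e6
    · exact absurd h zz
  rcases h2 a y b' z₂ hay f2 (nX _ ha _ hb'X) (nX _ ha _ hz₂X) (nX _ hy _ hb'X)
    (nX _ hy _ hz₂X) with h | h | h | h <;> contradiction

/-- In a `2K₂`-free graph with an edge `ab` and a minimal dominating set `X` containing `a`
and `b` with `|X| > α(G)`, with `N, A, Y, Z` as in the paper, if `|Y| > 1` then every vertex
of `Y` is adjacent to both `a` and `b`. -/
theorem twoK2Free_claim4 {V : Type*} [Fintype V] (G : SimpleGraph V) (h2 : TwoK2Free G)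
    (a b : V) (hab : G.Adj a b)
    (X : Set V) (hX : MinimalDominating G X) (ha : a ∈ X) (hb : b ∈ X)
    (hbig : indepNum G < X.ncard)
    (N A Y Z : Set V)
    (hN : N = {v : V | v ≠ a ∧ v ≠ b ∧ (G.Adj a v ∨ G.Adj b v)})
    (hA : A = {v : V | ¬ G.Adj a v ∧ ¬ G.Adj b v})
    (hY : Y = X ∩ N)
    (hZ : Z = {v ∈ A | ∃ y ∈ Y, G.Adj y v})
    (hY1 : 1 < Y.ncard) :
    ∀ y ∈ Y, G.Adj a y ∧ G.Adj b y := by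
  subst hN
  subst hY
  rintro y hy
  obtain ⟨y₂, hy₂, hne⟩ := Set.exists_ne_of_one_lt_ncard hY1 y
  obtain ⟨hyX, hya, hyb, hadj⟩ := hy
  obtain ⟨hy₂X, hy₂a, hy₂b, hadj₂⟩ := hy₂
  rcases hadj with h | h
  · exact ⟨h, claim4_aux G h2 a b hab X hX ha hb y y₂ hyX hy₂X hne.symm hyb hy₂a hy₂b h hadj₂⟩
  · exact ⟨claim4_aux G h2 b a hab.symm X hX hb ha y y₂ hyX hy₂X hne.symm hya hy₂b hy₂a h
      hadj₂.symm, h⟩
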